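/- Let X̂ be a real M×N matrix, H a real D×M matrix, and R a symmetric positive definite real D×D matrix. Set P♭ = X̂ X̂ᵀ, T = (I_N + (H X̂)ᵀ R⁻¹ (H X̂))⁻¹, and K = P♭ Hᵀ (H P♭ Hᵀ + R)⁻¹. Then X̂ T X̂ᵀ = (I_M − K H) P♭. -/

import Mathlib

open Matrix

/-- The ensemble transform Kalman filter identity: with `P♭ = X̂ X̂ᵀ`,
`T = (I + (H X̂)ᵀ R⁻¹ (H X̂))⁻¹` and `K = P♭ Hᵀ (H P♭ Hᵀ + R)⁻¹`, one has
`X̂ T X̂ᵀ = (I − K H) P♭`. -/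
theorem etkf_transform_covariance_identity
    (M N D : ℕ)
    (X : Matrix (Fin M) (Fin N) ℝ)
    (H : Matrix (Fin D) (Fin M) ℝ)
    (R : Matrix (Fin D) (Fin D) ℝ) (hR : R.PosDef)
    (P : Matrix (Fin M) (Fin M) ℝ) (hP : P = X * X.transpose)
    (T : Matrix (Fin N) (Fin N) ℝ)
    (hT : T = (1 + (H * X).transpose * R⁻¹ * (H * X))⁻¹)
    (K : Matrix (Fin M) (Fin D) ℝ)
    (hK : K = P * H.transpose * (H * P * H.transpose + R)⁻¹) :
    X * T * X.transpose = (1 - K * H) * P := by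
  have hC : (R⁻¹)⁻¹ = R := nonsing_inv_nonsing_inv R ((isUnit_iff_isUnit_det R).mp hR.isUnit)
  have hS : IsUnit ((R⁻¹)⁻¹ + H * X * (1 : Matrix (Fin N) (Fin N) ℝ)⁻¹ * (H * X).transpose) := by
    rw [hC, inv_one, Matrix.mul_one, ← conjTranspose_eq_transpose_of_trivial]
    exact (hR.add_posSemidef (posSemidef_self_mul_conjTranspose (H * X))).isUnit
  have hW := add_mul_mul_inv_eq_sub 1 (H * X).transpose R⁻¹ (H * X) isUnit_one hR.inv.isUnit hS
  have hI : R + H * X * (H * X).transpose = H * P * H.transpose + R := by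
    rw [hP, add_comm, transpose_mul]
    simp only [Matrix.mul_assoc]
  rw [hC, inv_one, Matrix.mul_one, Matrix.one_mul, Matrix.mul_one, hI] at hW
  rw [hT, hW, hK, Matrix.mul_sub, Matrix.sub_mul, Matrix.sub_mul, Matrix.one_mul, Matrix.mul_one,
    ← hP]
  congr 1
  generalize (H * P * H.transpose + R)⁻¹ = S
  rw [hP, transpose_mul]
  simp only [Matrix.mul_assoc]
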